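/- Let G be the subgroup of GL₂(𝔽₇) generated by the matrices [[6,0],[0,6]], [[1,0],[0,3]] and [[1,1],[0,1]] (the group labeled 7B.6.1, of order 84). If H is a subgroup of G of order 42 such that some nonzero vector of 𝔽₇² is fixed by every element of H, then H = {M ∈ G : the upper-left entry of M equals 1}, i.e., H is exactly the set of matrices [[1,b],[0,c]] with b ∈ 𝔽₇ and c ∈ 𝔽₇^×. -/

import Mathlib

/-!
STATEMENT 18: Let G ≤ GL₂(𝔽₇) be generated by [[6,0],[0,6]], [[1,0],[0,3]] and
[[1,1],[0,1]] (the group 7B.6.1, of order 84).  If H ≤ G has order 42 and some nonzero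
vector of 𝔽₇² is fixed by every element of H, then H is exactly the set of M ∈ G whose
upper-left entry is 1, i.e. the set of matrices [[1,b],[0,c]] with b ∈ 𝔽₇, c ∈ 𝔽₇ˣ.
-/

open Matrix

theorem statement_18
    (G : Subgroup (GL (Fin 2) (ZMod 7)))
    (hG : G = Subgroup.closure
      {(⟨!![6,0;0,6], !![6,0;0,6], by decide, by decide⟩ : GL (Fin 2) (ZMod 7)),
       (⟨!![1,0;0,3], !![1,0;0,5], by decide, by decide⟩ : GL (Fin 2) (ZMod 7)),
       (⟨!![1,1;0,1], !![1,6;0,1], by decide, by decide⟩ : GL (Fin 2) (ZMod 7))})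
    (H : Subgroup (GL (Fin 2) (ZMod 7))) (hHG : H ≤ G) (hH42 : Nat.card H = 42)
    (v : Fin 2 → ZMod 7) (hv : v ≠ 0)
    (hfix : ∀ M ∈ H, Matrix.mulVec (M : Matrix (Fin 2) (Fin 2) (ZMod 7)) v = v) :
    (∀ M : GL (Fin 2) (ZMod 7),
      M ∈ H ↔ M ∈ G ∧ (M : Matrix (Fin 2) (Fin 2) (ZMod 7)) 0 0 = 1) ∧
    (∀ M : GL (Fin 2) (ZMod 7),
      M ∈ H ↔ ∃ b c : ZMod 7, c ≠ 0 ∧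
        (M : Matrix (Fin 2) (Fin 2) (ZMod 7)) = !![1, b; 0, c]) := by
  have hG10 : ∀ M ∈ G, (M : Matrix (Fin 2) (Fin 2) (ZMod 7)) 1 0 = 0 := by
    intro M hM
    rw [hG] at hM
    induction hM using Subgroup.closure_induction with
    | mem x hx =>
      simp only [Set.mem_insert_iff, Set.mem_singleton_iff] at hx
      rcases hx with rfl | rfl | rfl <;> rfl
    | one => simp
    | mul x y _ _ hx hy =>
      simp [Matrix.mul_apply, Fin.sum_univ_two, hx, hy]
    | inv x _ hx =>
      rw [Matrix.coe_units_inv, Matrix.inv_def, Matrix.adjugate_fin_two]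
      simp [hx]
  have h11 : ∀ M ∈ G, (M : Matrix (Fin 2) (Fin 2) (ZMod 7)) 1 1 ≠ 0 := by
    intro M hM h
    have hd : IsUnit (M : Matrix (Fin 2) (Fin 2) (ZMod 7)).det :=
      (Matrix.isUnit_iff_isUnit_det _).1 M.isUnit
    rw [Matrix.det_fin_two, hG10 M hM, h] at hd
    simp at hd
    exact absurd hd (by decide)
  have hf : ∀ M ∈ H, (M : Matrix (Fin 2) (Fin 2) (ZMod 7)) 0 0 * v 0
        + (M : Matrix (Fin 2) (Fin 2) (ZMod 7)) 0 1 * v 1 = v 0 ∧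
      (M : Matrix (Fin 2) (Fin 2) (ZMod 7)) 1 1 * v 1 = v 1 := by
    intro M hM
    have h := hfix M hM
    have h0 := congrFun h 0
    have h1 := congrFun h 1
    simp only [Matrix.mulVec, dotProduct, Fin.sum_univ_two] at h0 h1
    rw [hG10 M (hHG hM), zero_mul, zero_add] at h1
    exact ⟨h0, h1⟩
  have hcard : Nat.card (ZMod 7 × {c : ZMod 7 // c ≠ 0}) ≤ 42 := by
    rw [Nat.card_eq_fintype_card]
    decide
  have : Fact (Nat.Prime 7) := ⟨by norm_num⟩
  have hv1 : v 1 = 0 := by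
    by_contra hv1
    have hinj : Function.Injective (fun M : H =>
        ((M : GL (Fin 2) (ZMod 7)) : Matrix (Fin 2) (Fin 2) (ZMod 7)) 0 0) := by
      rintro ⟨M, hM⟩ ⟨N, hN⟩ hMN
      simp only at hMN
      obtain ⟨a1, a2⟩ := hf M hM
      obtain ⟨b1, b2⟩ := hf N hN
      apply Subtype.ext
      apply Units.ext
      ext i j
      fin_cases i <;> fin_cases j
      · exact hMN
      · refine mul_right_cancel₀ hv1 ?_
        rw [hMN] at a1
        exact add_left_cancel (a1.trans b1.symm)
      · exact (hG10 M (hHG hM)).trans (hG10 N (hHG hN)).symm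
      · exact mul_right_cancel₀ hv1 (a2.trans b2.symm)
    have := Nat.card_le_card_of_injective _ hinj
    rw [hH42, Nat.card_zmod] at this
    omega
  have hv0 : v 0 ≠ 0 := by
    intro h
    apply hv
    ext i
    fin_cases i
    · exact h
    · exact hv1
  have h00 : ∀ M ∈ H, (M : Matrix (Fin 2) (Fin 2) (ZMod 7)) 0 0 = 1 := by
    intro M hM
    have h := (hf M hM).1
    rw [hv1, mul_zero, add_zero] at h
    exact mul_right_cancel₀ hv0 (h.trans (one_mul _).symm)
  let f : H → ZMod 7 × {c : ZMod 7 // c ≠ 0} := fun M =>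
    (((M : GL (Fin 2) (ZMod 7)) : Matrix (Fin 2) (Fin 2) (ZMod 7)) 0 1,
      ⟨((M : GL (Fin 2) (ZMod 7)) : Matrix (Fin 2) (Fin 2) (ZMod 7)) 1 1, h11 M (hHG M.2)⟩)
  have hinj : Function.Injective f := by
    rintro ⟨M, hM⟩ ⟨N, hN⟩ hMN
    simp only [f, Prod.mk.injEq, Subtype.mk.injEq] at hMN
    apply Subtype.ext
    apply Units.ext
    ext i j
    fin_cases i <;> fin_cases j
    · exact (h00 M hM).trans (h00 N hN).symm
    · exact hMN.1
    · exact (hG10 M (hHG hM)).trans (hG10 N (hHG hN)).symm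
    · exact hMN.2
  have hbij : Function.Bijective f := by
    refine hinj.bijective_of_nat_card_le ?_
    rw [hH42]
    exact hcard
  have key : ∀ M : GL (Fin 2) (ZMod 7),
      M ∈ H ↔ ∃ b c : ZMod 7, c ≠ 0 ∧
        (M : Matrix (Fin 2) (Fin 2) (ZMod 7)) = !![1, b; 0, c] := by
    intro M
    have hform : ∀ N ∈ H, (N : Matrix (Fin 2) (Fin 2) (ZMod 7)) =
        !![1, (N : Matrix (Fin 2) (Fin 2) (ZMod 7)) 0 1;
           0, (N : Matrix (Fin 2) (Fin 2) (ZMod 7)) 1 1] := by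
      intro N hN
      ext i j
      fin_cases i <;> fin_cases j
      · exact h00 N hN
      · rfl
      · exact hG10 N (hHG hN)
      · rfl
    constructor
    · intro hM
      exact ⟨_, _, h11 M (hHG hM), hform M hM⟩
    · rintro ⟨b, c, hc, hMe⟩
      obtain ⟨⟨N, hN⟩, hNe⟩ := hbij.2 (b, ⟨c, hc⟩)
      simp only [f, Prod.mk.injEq, Subtype.mk.injEq] at hNe
      have : M = N := by
        apply Units.ext
        rw [hMe, hform N hN, hNe.1, hNe.2]
      rw [this]
      exact hN
  refine ⟨fun M => ⟨fun hM => ⟨hHG hM, h00 M hM⟩, ?_⟩, key⟩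
  rintro ⟨hM, h1⟩
  refine (key M).2 ⟨(M : Matrix (Fin 2) (Fin 2) (ZMod 7)) 0 1, _, h11 M hM, ?_⟩
  ext i j
  fin_cases i <;> fin_cases j
  · exact h1
  · rfl
  · exact hG10 M hM
  · rfl
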